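/- Representation Formula: let Ω ⊆ ℍ be a (1,3)-symmetric (1,3)-slice domain and let f : Ω → ℍ be a (1,3)-regular function. Then for all z ∈ ℂ, β ∈ ℝ and all I, J, K ∈ S¹ with J ≠ K such that z+βI ∈ Ω: f(z+βI) = ((J−K)⁻¹J + I(J−K)⁻¹)·f(z+βJ) − ((J−K)⁻¹K + I(J−K)⁻¹)·f(z+βK). In particular, f(z+βI) = ((1−IJ)/2)·f(z+βJ) + ((1+IJ)/2)·f(z−βJ) for all I, J ∈ S¹ with z+βI ∈ Ω. -/

import Mathlib

open Quaternion

noncomputable section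

/-- The real quaternions. -/
abbrev H : Type := Quaternion ℝ

/-- The imaginary unit `i`. -/
def qi : H := ⟨0, 1, 0, 0⟩
/-- The imaginary unit `j`. -/
def qj : H := ⟨0, 0, 1, 0⟩
/-- The imaginary unit `k`. -/
def qk : H := ⟨0, 0, 0, 1⟩

/-- `S¹`: the circle of unit quaternions in the plane `jℝ + kℝ`. -/
def S1 : Set H := {J : H | J.re = 0 ∧ J.imI = 0 ∧ J.imJ ^ 2 + J.imK ^ 2 = 1}

/-- The subset `ℂ = ℝ + iℝ` of `ℍ` (the mirror). -/
def Cset : Set H := {x : H | x.imJ = 0 ∧ x.imK = 0}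

/-- Coordinates `(x₀,x₁,β) ↦ x₀ + i x₁ + β J` for the hyperplane `ℝ³_J`. -/
def psi (J : H) (u : ℝ × ℝ × ℝ) : H := (u.1 : H) + u.2.1 • qi + u.2.2 • J

/-- The hyperplane `ℝ³_J = Span_ℝ(1, i, J)` of `ℍ`, as the range of `psi J`. -/
def hplane (J : H) : Set H := Set.range (psi J)

/-- `f` is `J`-monogenic on the `J`-hplane of `Ω`: in the coordinates `(x₀,x₁,β)`,
the restriction of `f` to `Ω ∩ ℝ³_J` is real-differentiable and satisfies
`∂_{x₀}f + i·∂_{x₁}f + J·∂_βf = 0`. -/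
def JMonogenicOn (J : H) (f : H → H) (Ω : Set H) : Prop :=
  ∀ u : ℝ × ℝ × ℝ, psi J u ∈ Ω →
    DifferentiableAt ℝ (fun v => f (psi J v)) u ∧
    fderiv ℝ (fun v => f (psi J v)) u (1, 0, 0)
      + qi * fderiv ℝ (fun v => f (psi J v)) u (0, 1, 0)
      + J * fderiv ℝ (fun v => f (psi J v)) u (0, 0, 1) = 0

/-- `f` is `(1,3)`-regular on `Ω`: for every `J ∈ S¹`, the restriction of `f`
to `Ω ∩ ℝ³_J` is `J`-monogenic. -/
def Regular13 (f : H → H) (Ω : Set H) : Prop :=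
  ∀ J ∈ S1, JMonogenicOn J f Ω

/-- `Ω` is a `(1,3)`-slice domain: a domain intersecting the mirror `ℂ`, whose
`J`-slices `Ω ∩ ℝ³_J` are all connected. -/
def IsSliceDomain13 (Ω : Set H) : Prop :=
  IsOpen Ω ∧ IsConnected Ω ∧ (Ω ∩ Cset).Nonempty ∧
  ∀ J ∈ S1, IsConnected (Ω ∩ hplane J)

/-- `Ω` is `(1,3)`-symmetric: whenever `z + βJ ∈ Ω` (`z ∈ ℂ`, `β ∈ ℝ`, `J ∈ S¹`),
also `z + βK ∈ Ω` for every `K ∈ S¹`. -/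
def IsSymmetric13 (Ω : Set H) : Prop :=
  ∀ z ∈ Cset, ∀ β : ℝ, ∀ J ∈ S1, z + β • J ∈ Ω → ∀ K ∈ S1, z + β • K ∈ Ω

section MonogenicFunctions

open MeasureTheory Metric

/-- The truncated kernel `(s² - |x|²)₊ ^ n` on `ℝ³`. -/
def bump (s : ℝ) (n : ℕ) (x : Fin 3 → ℝ) : ℝ := max (s ^ 2 - ∑ i, x i ^ 2) 0 ^ n

/-- The units `e` satisfy the Clifford relation `x̄ x = |x|²` for `x = ∑ xᵢ eᵢ`. -/
def IsCliffordTriple (e : Fin 3 → H) : Prop :=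
  ∀ x : Fin 3 → ℝ, star (∑ i, x i • e i) * (∑ i, x i • e i) = ((∑ i, x i ^ 2 : ℝ) : H)

/-- `g` is differentiable on `V` and annihilated by `∑ eᵢ ∂ᵢ`. -/
def MonogenicOn (e : Fin 3 → H) (g : (Fin 3 → ℝ) → H) (V : Set (Fin 3 → ℝ)) : Prop :=
  ∀ u ∈ V, DifferentiableAt ℝ g u ∧ ∑ i, e i * fderiv ℝ g u (Pi.single i 1) = 0

lemma hasDerivAt_max_zero_pow (n : ℕ) (t : ℝ) :
    HasDerivAt (fun t : ℝ => max t 0 ^ (n + 2)) ((n + 2) * max t 0 ^ (n + 1)) t := by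
  rcases lt_trichotomy t 0 with ht | rfl | ht
  · have h : (fun t : ℝ => max t 0 ^ (n + 2)) =ᶠ[nhds t] fun _ => 0 := by
      filter_upwards [gt_mem_nhds ht] with x hx
      simp [max_eq_right hx.le]
    simpa [max_eq_right ht.le] using (hasDerivAt_const t (0 : ℝ)).congr_of_eventuallyEq h
  · have h : HasDerivAt (fun t : ℝ => max t 0 ^ (n + 2)) 0 0 := by
      rw [hasDerivAt_iff_isLittleO_nhds_zero]
      have h2 : (fun h : ℝ => h ^ 2) =o[nhds 0] fun h : ℝ => h := by
        simpa using Asymptotics.isLittleO_pow_pow (𝕜 := ℝ) (show 1 < 2 by norm_num)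
      refine Asymptotics.IsBigO.trans_isLittleO ?_ h2
      refine Asymptotics.IsBigO.of_bound 1 ?_
      filter_upwards [ball_mem_nhds (0 : ℝ) one_pos] with x hx
      have hx' : |x| ≤ 1 := by simpa using (mem_ball.1 hx).le
      have h3 : |max x 0| ≤ |x| := by
        rcases le_total x 0 with h | h
        · simp [max_eq_right h]
        · simp [max_eq_left h]
      have h4 : |max x 0| ^ (n + 2) ≤ |x| ^ 2 := by
        calc |max x 0| ^ (n + 2) ≤ |x| ^ (n + 2) := by gcongr
          _ ≤ |x| ^ 2 := pow_le_pow_of_le_one (abs_nonneg _) hx' (by omega)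
      simpa [abs_pow] using h4
    simpa using h
  · have h : (fun t : ℝ => max t 0 ^ (n + 2)) =ᶠ[nhds t] fun t => t ^ (n + 2) := by
      filter_upwards [lt_mem_nhds ht] with x hx
      simp [max_eq_left hx.le]
    have := (hasDerivAt_pow (n + 2) t).congr_of_eventuallyEq h
    simpa [max_eq_left ht.le] using this

lemma contDiff_max_zero_pow_three : ContDiff ℝ 2 (fun t : ℝ => max t 0 ^ 3) := by
  have h1 : deriv (fun t : ℝ => max t 0 ^ 3) = fun t => 3 * max t 0 ^ 2 := by
    funext t
    rw [(hasDerivAt_max_zero_pow 1 t).deriv]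
    norm_num
  have h2 : deriv (fun t : ℝ => 3 * max t 0 ^ 2) = fun t => 3 * (2 * max t 0) := by
    funext t
    rw [((hasDerivAt_max_zero_pow 0 t).const_mul 3).deriv]
    norm_num
  rw [show (2 : WithTop ℕ∞) = 1 + 1 by norm_num, contDiff_succ_iff_deriv, h1]
  refine ⟨fun t => (hasDerivAt_max_zero_pow 1 t).differentiableAt, by simp, ?_⟩
  rw [contDiff_one_iff_deriv, h2]
  refine ⟨fun t => ((hasDerivAt_max_zero_pow 0 t).const_mul 3).differentiableAt, ?_⟩
  fun_prop

lemma bump_nonneg (s : ℝ) (n : ℕ) (x : Fin 3 → ℝ) : 0 ≤ bump s n x := by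
  unfold bump; positivity

lemma bump_le (s : ℝ) (n : ℕ) (x : Fin 3 → ℝ) : bump s n x ≤ (s ^ 2) ^ n := by
  unfold bump
  gcongr
  refine max_le ?_ (by positivity)
  have : 0 ≤ ∑ i, x i ^ 2 := by positivity
  linarith

lemma norm_sq_le_sum (x : Fin 3 → ℝ) : ‖x‖ ^ 2 ≤ ∑ i, x i ^ 2 := by
  obtain ⟨i, hi⟩ := Finite.exists_max fun i => ‖x i‖
  have h : ‖x‖ ≤ ‖x i‖ := (pi_norm_le_iff_of_nonneg (norm_nonneg _)).2 hi
  calc ‖x‖ ^ 2 ≤ ‖x i‖ ^ 2 := by gcongr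
    _ = x i ^ 2 := by simp
    _ ≤ _ := Finset.single_le_sum (f := fun i => x i ^ 2) (fun i _ => sq_nonneg _)
      (Finset.mem_univ i)

lemma bump_eq_zero {s : ℝ} (hs : 0 ≤ s) {n : ℕ} (hn : n ≠ 0) {x : Fin 3 → ℝ} (hx : s ≤ ‖x‖) :
    bump s n x = 0 := by
  have h1 : s ^ 2 ≤ ‖x‖ ^ 2 := by gcongr
  have h2 := norm_sq_le_sum x
  unfold bump
  rw [max_eq_right (by linarith), zero_pow hn]

lemma continuous_bump (s : ℝ) (n : ℕ) : Continuous (bump s n) := by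
  unfold bump; fun_prop

lemma contDiff_bump (s : ℝ) : ContDiff ℝ 2 (bump s 3) := by
  have : ContDiff ℝ 2 fun x : Fin 3 → ℝ => s ^ 2 - ∑ i, x i ^ 2 := by fun_prop
  exact contDiff_max_zero_pow_three.comp this

lemma hasFDerivAt_bump_three (s : ℝ) (x : Fin 3 → ℝ) :
    ∃ φ : (Fin 3 → ℝ) →L[ℝ] ℝ, HasFDerivAt (bump s 3) φ x ∧
      ∀ i, φ (Pi.single i 1) = -(6 * x i * bump s 2 x) := by
  have h1 : HasFDerivAt (fun x : Fin 3 → ℝ => s ^ 2 - ∑ i, x i ^ 2)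
      (-∑ i, (2 * x i) • (ContinuousLinearMap.proj i : (Fin 3 → ℝ) →L[ℝ] ℝ)) x := by
    refine HasFDerivAt.const_sub ?_ _
    refine HasFDerivAt.fun_sum fun i _ => ?_
    have := (hasFDerivAt_apply (𝕜 := ℝ) i x).pow 2
    simpa using! this
  refine ⟨_, (hasDerivAt_max_zero_pow 1 _).comp_hasFDerivAt x h1, fun i => ?_⟩
  simp [bump, Pi.single_apply]
  ring

lemma hasDerivAt_bump (s : ℝ) (x : Fin 3 → ℝ) :
    HasDerivAt (fun s => bump s 3 x) (6 * s * bump s 2 x) s := by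
  have h1 : HasDerivAt (fun s : ℝ => s ^ 2 - ∑ i, x i ^ 2) (2 * s) s := by
    simpa using (hasDerivAt_pow 2 s).sub_const (∑ i, x i ^ 2)
  have := (hasDerivAt_max_zero_pow 1 _).comp s h1
  refine this.congr_deriv ?_
  simp only [bump, Nat.cast_one]
  ring

lemma bump_three_eq (s : ℝ) (x : Fin 3 → ℝ) :
    bump s 3 x = bump s 2 x * (s ^ 2 - ∑ i, x i ^ 2) := by
  unfold bump
  rcases le_total (s ^ 2 - ∑ i, x i ^ 2) 0 with h | h
  · simp [max_eq_right h]
  · simp only [max_eq_left h]; ring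

lemma closedBall_eq_Icc (y : Fin 3 → ℝ) {R : ℝ} (hR : 0 ≤ R) :
    closedBall y R = Set.Icc (fun i => y i - R) (fun i => y i + R) := by
  rw [closedBall_pi _ hR, ← Set.pi_univ_Icc]
  simp only [Real.closedBall_eq_Icc]

variable {e : Fin 3 → H} {g : (Fin 3 → ℝ) → H} {V : Set (Fin 3 → ℝ)} {y : Fin 3 → ℝ} {R s : ℝ}

lemma MonogenicOn.mono {W : Set (Fin 3 → ℝ)} (hg : MonogenicOn e g V) (h : W ⊆ V) :
    MonogenicOn e g W := fun u hu => hg u (h hu)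

lemma MonogenicOn.continuousOn (hg : MonogenicOn e g V) : ContinuousOn g V :=
  fun u hu => (hg u hu).1.continuousAt.continuousWithinAt

/-- Cauchy's theorem tested against `(s² - |x - y|²)₊³`. -/
lemma integral_bump_three (he : IsCliffordTriple e) (hs : 0 ≤ s) (hsR : s ≤ R)
    (hg : MonogenicOn e g (closedBall y R)) :
    ∫ x in closedBall y R, (9 * bump s 3 (x - y) - 6 * s ^ 2 * bump s 2 (x - y)) • g x = 0 := by
  have hR : 0 ≤ R := hs.trans hsR
  have hone : ∀ i, star (e i) * e i = 1 := fun i => by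
    have := he (Pi.single i 1)
    fin_cases i <;> simpa [Fin.sum_univ_three] using this
  let L : (Fin 3 → ℝ) →L[ℝ] H :=
    ∑ i, (ContinuousLinearMap.proj i : (Fin 3 → ℝ) →L[ℝ] ℝ).smulRight (star (e i))
  have hL : ∀ x, L x = star (∑ i, x i • e i) := fun x => by
    simp [L]
  have hLs : ∀ i, L (Pi.single i 1) = star (e i) := fun i => by
    rw [hL]
    fin_cases i <;> simp
  choose φ hφ hφs using hasFDerivAt_bump_three s
  let F : Fin 3 → (Fin 3 → ℝ) → H := fun i x => bump s 3 (x - y) • (L (x - y) * e i * g x)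
  let F' : Fin 3 → (Fin 3 → ℝ) → (Fin 3 → ℝ) →L[ℝ] H := fun i x => fderiv ℝ (F i) x
  have key : ∀ x ∈ closedBall y R, ∀ i, DifferentiableAt ℝ (F i) x ∧
      F' i x (Pi.single i 1) = bump s 3 (x - y) • (g x + L (x - y) *
        (e i * fderiv ℝ g x (Pi.single i 1)))
        - (6 * bump s 2 (x - y)) • (L (x - y) * ((x - y) i • e i) * g x) := by
    intro x hx i
    have hb : HasFDerivAt (fun x => bump s 3 (x - y)) (φ (x - y)) x := by
      simpa [Function.comp_def] using! (hφ (x - y)).comp x ((hasFDerivAt_id x).sub_const y)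
    have hl : HasFDerivAt (fun x => L (x - y)) L x := by
      simpa only [ContinuousLinearMap.comp_id, Function.comp_def, id] using!
        L.hasFDerivAt.comp x ((hasFDerivAt_id x).sub_const y)
    have hF := hb.smul ((hl.mul_const' (e i)).mul' (hg x hx).1.hasFDerivAt)
    refine ⟨hF.differentiableAt, ?_⟩
    have : F' i x = _ := hF.fderiv
    rw [this]
    simp [hφs, hLs, hone, mul_assoc, ← smul_smul, smul_add]
    module
  have hdiv : ∀ x ∈ closedBall y R, ∑ i, F' i x (Pi.single i 1) =
      (9 * bump s 3 (x - y) - 6 * s ^ 2 * bump s 2 (x - y)) • g x := by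
    intro x hx
    simp only [fun i => (key x hx i).2]
    rw [Finset.sum_sub_distrib, ← Finset.smul_sum, ← Finset.smul_sum, Finset.sum_add_distrib,
      ← Finset.mul_sum, (hg x hx).2, ← Finset.sum_mul, ← Finset.mul_sum, hL, he,
      Quaternion.coe_mul_eq_smul, bump_three_eq]
    simp only [mul_zero, add_zero, Finset.sum_const, Finset.card_univ, Fintype.card_fin]
    module
  have hcont : ContinuousOn (fun x => (9 * bump s 3 (x - y) - 6 * s ^ 2 * bump s 2 (x - y)) • g x)
      (closedBall y R) := by
    refine ContinuousOn.fun_smul (Continuous.continuousOn ?_) hg.continuousOn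
    have := continuous_bump s 3
    have := continuous_bump s 2
    fun_prop
  have hint := hcont.integrableOn_compact (μ := volume) (isCompact_closedBall y R)
  have hm : MeasurableSet (closedBall y R) := measurableSet_closedBall
  rw [← setIntegral_congr_fun hm hdiv]
  have hint' : IntegrableOn (fun x => ∑ i, F' i x (Pi.single i 1)) (closedBall y R) :=
    hint.congr_fun (fun x hx => (hdiv x hx).symm) hm
  rw [closedBall_eq_Icc y hR] at *
  rw [integral_divergence_of_hasFDerivAt_off_countable' _ _ (fun i => by simp; linarith) F F' ∅
    Set.countable_empty (fun i x hx => (key x hx i).1.continuousAt.continuousWithinAt) ?_ hint']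
  · refine Finset.sum_eq_zero fun i _ => ?_
    have hz : ∀ c, |c - y i| = R → ∀ x, F i (i.insertNth (α := fun _ => ℝ) c x) = 0 := by
      intro c hc x
      have : R ≤ ‖i.insertNth (α := fun _ => ℝ) c x - y‖ := by
        have := norm_le_pi_norm (i.insertNth (α := fun _ => ℝ) c x - y) i
        simpa [hc] using this
      simp [F, bump_eq_zero hs three_ne_zero (hsR.trans this)]
    have h1 := hz (y i + R) (by simp [abs_of_nonneg hR])
    have h2 := hz (y i - R) (by simp [abs_of_nonneg hR])
    simp [h1, h2]
  · intro x hx i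
    refine (key x ?_ i).1.hasFDerivAt
    rw [← Set.pi_univ_Icc]
    exact fun i hi => Set.Ioo_subset_Icc_self (hx.1 i hi)

lemma MonogenicOn.sub_const (hg : MonogenicOn e g V) (c : H) :
    MonogenicOn e (fun x => g x - c) V := fun u hu =>
  ⟨(hg u hu).1.sub_const c, by simpa [fderiv_sub_const] using (hg u hu).2⟩

lemma integrableOn_bump_smul (hg : ContinuousOn g (closedBall y R)) (s : ℝ) (n : ℕ) :
    IntegrableOn (fun x => bump s n (x - y) • g x) (closedBall y R) := by
  refine ContinuousOn.integrableOn_compact (isCompact_closedBall y R) ?_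
  refine ContinuousOn.fun_smul (Continuous.continuousOn ?_) hg
  exact (continuous_bump s n).comp (continuous_id.sub continuous_const)

lemma hasDerivAt_integral_bump (he : IsCliffordTriple e) (hs : s ∈ Set.Ioo 0 R)
    (hg : MonogenicOn e g (closedBall y R)) :
    HasDerivAt (fun s => ∫ x in closedBall y R, bump s 3 (x - y) • g x)
      ((9 / s) • ∫ x in closedBall y R, bump s 3 (x - y) • g x) s := by
  obtain ⟨M, hM⟩ := (isCompact_closedBall y R).exists_bound_of_continuousOn hg.continuousOn
  have hi := integrableOn_bump_smul hg.continuousOn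
  have hd := hasDerivAt_integral_of_dominated_loc_of_deriv_le (μ := volume.restrict (closedBall y R))
    (F := fun s x => bump s 3 (x - y) • g x)
    (F' := fun s x => (6 * s * bump s 2 (x - y)) • g x) (x₀ := s)
    (bound := fun _ => (6 * R * (R ^ 2) ^ 2) * M) (Ioo_mem_nhds hs.1 hs.2)
    (.of_forall fun s => (hi s 3).aestronglyMeasurable) (hi s 3)
    (by
      simp only [mul_smul]
      exact (((hi s 2).smul s).smul (6 : ℝ)).aestronglyMeasurable)
    (by
      filter_upwards [ae_restrict_mem measurableSet_closedBall] with x hx t ht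
      have hb := bump_nonneg t 2 (x - y)
      have ht0 := ht.1.le
      have hRt := ht.2.le
      have hR0 := ht0.trans hRt
      rw [norm_smul, Real.norm_of_nonneg (by positivity)]
      gcongr
      · exact (bump_le _ _ _).trans (by gcongr)
      · exact hM x hx)
    (integrableOn_const measure_closedBall_lt_top.ne)
    (.of_forall fun x t _ => (hasDerivAt_bump t (x - y)).smul_const (g x))
  refine hd.2.congr_deriv ?_
  have h0 := integral_bump_three he hs.1.le hs.2.le hg
  simp only [sub_smul, mul_smul] at h0 ⊢
  have hi3 : IntegrableOn (fun x => (9 : ℝ) • bump s 3 (x - y) • g x) (closedBall y R) :=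
    (hi s 3).smul (9 : ℝ)
  have hi2 : IntegrableOn (fun x => (6 : ℝ) • s ^ 2 • bump s 2 (x - y) • g x) (closedBall y R) :=
    ((hi s 2).smul (s ^ 2)).smul (6 : ℝ)
  rw [integral_sub hi3 hi2] at h0
  simp only [integral_smul] at h0 ⊢
  have hs0 := hs.1.ne'
  have h1 := sub_eq_zero.1 h0
  rw [div_eq_inv_mul, mul_smul, h1, smul_smul, smul_smul, smul_smul]
  congr 1
  field_simp

lemma MonogenicOn.integral_bump_eq_zero (he : IsCliffordTriple e) (hs : s ∈ Set.Ioo 0 R)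
    (hg : MonogenicOn e g (closedBall y R)) (hy : g y = 0) :
    ∫ x in closedBall y R, bump s 3 (x - y) • g x = 0 := by
  set A : ℝ → H := fun s => ∫ x in closedBall y R, bump s 3 (x - y) • g x with hA
  have hR : 0 ≤ R := hs.1.le.trans hs.2.le
  have hder : ∀ t ∈ Set.Ioo 0 R, HasDerivAt (fun t => (t ^ 9)⁻¹ • A t) 0 t := by
    intro t ht
    have ht0 := ht.1.ne'
    have h1 : HasDerivAt (fun t : ℝ => (t ^ 9)⁻¹) (-(9 * t ^ 8) / (t ^ 9) ^ 2) t := by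
      simpa using (hasDerivAt_pow 9 t).fun_inv (pow_ne_zero 9 ht0)
    refine (h1.fun_smul (hasDerivAt_integral_bump he ht hg)).congr_deriv ?_
    rw [smul_smul, ← add_smul]
    convert zero_smul ℝ _ using 2
    field_simp
    ring
  have hconst : ∀ t ∈ Set.Ioo 0 R, (t ^ 9)⁻¹ • A t = (s ^ 9)⁻¹ • A s := fun t ht =>
    isOpen_Ioo.is_const_of_deriv_eq_zero isPreconnected_Ioo
      (fun u hu => (hder u hu).differentiableAt.differentiableWithinAt)
      (fun u hu => (hder u hu).deriv) ht hs
  suffices h : (s ^ 9)⁻¹ • A s = 0 by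
    have := pow_ne_zero 9 hs.1.ne'
    simpa [this] using h
  rw [← norm_le_zero_iff]
  refine le_of_forall_pos_le_add fun ε hε => ?_
  obtain ⟨δ, hδ, hgδ⟩ := Metric.continuousAt_iff.1 (hg y (mem_closedBall_self hR)).1.continuousAt
    (ε / 8) (by positivity)
  obtain ⟨r, hr0, hr⟩ := exists_between (lt_min hδ (hs.1.trans hs.2))
  have hrR := hr.trans_le (min_le_right _ _)
  have hrδ := hr.trans_le (min_le_left _ _)
  rw [← hconst r ⟨hr0, hrR⟩, norm_smul]
  have hAr : A r = ∫ x in closedBall y r, bump r 3 (x - y) • g x := by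
    refine (setIntegral_eq_of_subset_of_forall_sdiff_eq_zero measurableSet_closedBall
      (closedBall_subset_closedBall hrR.le) fun x hx => ?_)
    have : r ≤ ‖x - y‖ := by
      have := hx.2
      simp only [mem_closedBall, not_le, dist_eq_norm] at this
      exact this.le
    rw [bump_eq_zero hr0.le three_ne_zero this, zero_smul]
  have hbound : ‖A r‖ ≤ ((r ^ 2) ^ 3 * (ε / 8)) * (2 * r) ^ 3 := by
    rw [hAr]
    refine (norm_setIntegral_le_of_norm_le_const (C := (r ^ 2) ^ 3 * (ε / 8))
      measure_closedBall_lt_top fun x hx => ?_).trans_eq ?_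
    · rw [norm_smul, Real.norm_of_nonneg (bump_nonneg _ _ _)]
      gcongr
      · exact bump_le _ _ _
      · have := hgδ (lt_of_le_of_lt (mem_closedBall.1 hx) hrδ)
        rw [hy, dist_zero_right] at this
        exact this.le
    · rw [measureReal_def, Real.volume_pi_closedBall _ hr0.le, ENNReal.toReal_ofReal (by positivity)]
      simp
  rw [norm_inv, Real.norm_of_nonneg (by positivity), zero_add, inv_mul_le_iff₀ (by positivity)]
  refine hbound.trans_eq ?_
  ring

/-- The mass of the kernel `(s² - |x|²)₊³`. -/
def bumpMass (s : ℝ) : ℝ := ∫ x, bump s 3 x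

lemma integrable_bump (hs : 0 ≤ s) : Integrable (bump s 3) := by
  refine (continuous_bump s 3).integrable_of_hasCompactSupport ?_
  refine HasCompactSupport.intro (isCompact_closedBall 0 s) fun x hx => ?_
  refine bump_eq_zero hs three_ne_zero ?_
  simpa using (not_le.1 (mt mem_closedBall_zero_iff.2 hx)).le

/-- Mean value property. -/
lemma MonogenicOn.integral_bump (he : IsCliffordTriple e) (hs : s ∈ Set.Ioo 0 R)
    (hg : MonogenicOn e g (closedBall y R)) :
    ∫ x in closedBall y R, bump s 3 (x - y) • g x = bumpMass s • g y := by
  have h := (hg.sub_const (g y)).integral_bump_eq_zero he hs (sub_self _)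
  have hc : ContinuousOn (fun _ => g y) (closedBall y R) := continuousOn_const
  simp only [smul_sub] at h
  rw [integral_sub (integrableOn_bump_smul hg.continuousOn s 3) (integrableOn_bump_smul hc s 3),
    sub_eq_zero, integral_smul_const] at h
  rw [h, setIntegral_eq_integral_of_forall_compl_eq_zero, integral_sub_right_eq_self (bump s 3)]
  · rfl
  · intro x hx
    refine bump_eq_zero hs.1.le three_ne_zero (hs.2.le.trans ?_)
    rw [← dist_eq_norm]
    exact (not_le.1 (mt mem_closedBall.2 hx)).le

lemma bumpMass_lower_bound (hs : 0 < s) : s ^ 9 / 64 ≤ bumpMass s := by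
  have h1 : ∫ x in closedBall (0 : Fin 3 → ℝ) (s / 2), (s ^ 2 / 4) ^ 3 ≤
      ∫ x in closedBall (0 : Fin 3 → ℝ) (s / 2), bump s 3 x := by
    refine setIntegral_mono_on (integrableOn_const measure_closedBall_lt_top.ne)
      (integrable_bump hs.le).integrableOn measurableSet_closedBall fun x hx => ?_
    unfold bump
    gcongr
    refine le_max_of_le_left ?_
    have : ∑ i, x i ^ 2 ≤ ∑ _i : Fin 3, (s / 2) ^ 2 := by
      refine Finset.sum_le_sum fun i _ => sq_le_sq' ?_ ?_ <;>
      · have h2 := (norm_le_pi_norm x i).trans (mem_closedBall_zero_iff.1 hx)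
        rw [Real.norm_eq_abs, abs_le] at h2
        linarith [h2.1, h2.2]
    simp at this
    linarith
  have h2 := setIntegral_le_integral (s := closedBall (0 : Fin 3 → ℝ) (s / 2))
    (integrable_bump hs.le) (.of_forall fun x => bump_nonneg s 3 x)
  refine le_trans (le_of_eq ?_) (h1.trans h2)
  rw [setIntegral_const, measureReal_def, Real.volume_pi_closedBall _ (by positivity),
    ENNReal.toReal_ofReal (by positivity)]
  simp
  ring

/-- Mean value property, integrating over a larger set than the ball. -/
lemma MonogenicOn.setIntegral_bump (he : IsCliffordTriple e) (hs : s ∈ Set.Ioo 0 R)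
    {B : Set (Fin 3 → ℝ)} (hB : MeasurableSet B) (hyB : closedBall y R ⊆ B)
    (hg : MonogenicOn e g B) :
    ∫ x in B, bump s 3 (x - y) • g x = bumpMass s • g y := by
  rw [← (hg.mono hyB).integral_bump he hs]
  refine setIntegral_eq_of_subset_of_forall_sdiff_eq_zero hB hyB fun x hx => ?_
  have h : R ≤ ‖x - y‖ := by
    rw [← dist_eq_norm]
    exact (not_le.1 (mt mem_closedBall.2 hx.2)).le
  rw [bump_eq_zero hs.1.le three_ne_zero (hs.2.le.trans h), zero_smul]

lemma abs_max_zero_pow_three_sub_le {a b c : ℝ} (ha : max a 0 ≤ c) (hb : max b 0 ≤ c) :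
    |max a 0 ^ 3 - max b 0 ^ 3| ≤ 3 * c ^ 2 * |a - b| := by
  have h1 : |max a 0 - max b 0| ≤ |a - b| := abs_max_sub_max_le_abs a b 0
  have ha0 : 0 ≤ max a 0 := le_max_right _ _
  have hb0 : 0 ≤ max b 0 := le_max_right _ _
  set p := max a 0
  set q := max b 0
  have hpq : p ^ 3 - q ^ 3 = (p ^ 2 + p * q + q ^ 2) * (p - q) := by ring
  rw [hpq, abs_mul, abs_of_nonneg (by positivity)]
  have h2 : p ^ 2 + p * q + q ^ 2 ≤ 3 * c ^ 2 := by
    have h3 : p ^ 2 ≤ c ^ 2 := by gcongr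
    have h4 : q ^ 2 ≤ c ^ 2 := by gcongr
    nlinarith [sq_nonneg (p - q)]
  gcongr

lemma abs_bump_sub_le {x z : Fin 3 → ℝ} {A : ℝ} (hA : ‖x + z‖ ≤ A) :
    |bump s 3 x - bump s 3 z| ≤ 9 * s ^ 4 * A * ‖x - z‖ := by
  have hb : ∀ x : Fin 3 → ℝ, max (s ^ 2 - ∑ i, x i ^ 2) 0 ≤ s ^ 2 := fun x => by
    simpa [bump] using bump_le s 1 x
  refine (abs_max_zero_pow_three_sub_le (hb x) (hb z)).trans ?_
  have h : |(s ^ 2 - ∑ i, x i ^ 2) - (s ^ 2 - ∑ i, z i ^ 2)| ≤ 3 * (A * ‖x - z‖) := by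
    have h1 : (s ^ 2 - ∑ i, x i ^ 2) - (s ^ 2 - ∑ i, z i ^ 2) =
        -∑ i, (x + z) i * (x - z) i := by
      simp only [Fin.sum_univ_three, Pi.add_apply, Pi.sub_apply]; ring
    rw [h1, abs_neg]
    refine (Finset.abs_sum_le_sum_abs _ _).trans ?_
    have h2 : ∀ i ∈ Finset.univ, |(x + z) i * (x - z) i| ≤ A * ‖x - z‖ := fun i _ => by
      rw [abs_mul]
      exact mul_le_mul ((norm_le_pi_norm (x + z) i).trans hA) (norm_le_pi_norm (x - z) i)
        (abs_nonneg _) ((norm_nonneg _).trans hA)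
    simpa using Finset.sum_le_sum h2
  calc _ ≤ 3 * (s ^ 2) ^ 2 * (3 * (A * ‖x - z‖)) := by gcongr
    _ = _ := by ring

/-- Cauchy estimate for the first derivative. -/
lemma MonogenicOn.norm_fderiv_le (he : IsCliffordTriple e) {r M : ℝ} (hr : 0 < r)
    (hg : MonogenicOn e g (closedBall y r)) (hM : ∀ x ∈ closedBall y r, ‖g x‖ ≤ M) :
    ‖fderiv ℝ g y‖ ≤ 400000 / r * M := by
  have hM0 : 0 ≤ M := (norm_nonneg _).trans (hM y (mem_closedBall_self hr.le))
  have hlow := bumpMass_lower_bound (half_pos hr)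
  have hpos : 0 < bumpMass (r / 2) := lt_of_lt_of_le (by positivity) hlow
  refine norm_fderiv_le_of_lip' ℝ (by positivity) ?_
  filter_upwards [closedBall_mem_nhds y (show 0 < r / 4 by positivity)] with z hz
  have hzn : ‖z - y‖ ≤ r / 4 := by simpa [dist_eq_norm] using hz
  have hsub : closedBall z (3 / 4 * r) ⊆ closedBall y r :=
    closedBall_subset_closedBall' (by rw [dist_eq_norm]; linarith)
  have hmz := hg.setIntegral_bump he (s := r / 2) ⟨by positivity, by linarith⟩
    measurableSet_closedBall hsub
  have hmy := hg.setIntegral_bump he (s := r / 2) ⟨by positivity, by linarith⟩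
    measurableSet_closedBall subset_rfl
  have hint : ∀ w : Fin 3 → ℝ,
      IntegrableOn (fun x => bump (r / 2) 3 (x - w) • g x) (closedBall y r) := fun w => by
    refine ContinuousOn.integrableOn_compact (isCompact_closedBall y r) ?_
    refine ContinuousOn.fun_smul (Continuous.continuousOn ?_) hg.continuousOn
    exact (continuous_bump _ 3).comp (continuous_id.sub continuous_const)
  have hdiff : bumpMass (r / 2) • (g z - g y) =
      ∫ x in closedBall y r, (bump (r / 2) 3 (x - z) - bump (r / 2) 3 (x - y)) • g x := by
    simp only [sub_smul]
    rw [integral_sub (hint z) (hint y), hmz, hmy, smul_sub]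
  have hle : ‖bumpMass (r / 2) • (g z - g y)‖ ≤
      ((9 * (r / 2) ^ 4 * (5 / 2 * r) * ‖z - y‖) * M) * (2 * r) ^ 3 := by
    rw [hdiff]
    refine (norm_setIntegral_le_of_norm_le_const
      (C := (9 * (r / 2) ^ 4 * (5 / 2 * r) * ‖z - y‖) * M)
      measure_closedBall_lt_top fun x hx => ?_).trans_eq ?_
    · rw [norm_smul]
      refine mul_le_mul ?_ (hM x hx) (norm_nonneg _) (by positivity)
      have hx' : ‖x - y‖ ≤ r := by simpa [dist_eq_norm] using hx
      have h1 : ‖(x - z) + (x - y)‖ ≤ 5 / 2 * r := by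
        have h2 : (x - z) + (x - y) = (x - y) + (x - y) - (z - y) := by abel
        rw [h2]
        have := norm_sub_le ((x - y) + (x - y)) (z - y)
        have := norm_add_le (x - y) (x - y)
        linarith
      have h3 := abs_bump_sub_le (s := r / 2) h1
      rwa [show (x - z) - (x - y) = -(z - y) by abel, norm_neg] at h3
    · rw [measureReal_def, Real.volume_pi_closedBall _ hr.le, ENNReal.toReal_ofReal (by positivity)]
      simp
  rw [norm_smul, Real.norm_of_nonneg hpos.le] at hle
  have h5 : (r / 2) ^ 9 / 64 * ‖g z - g y‖ ≤
      ((9 * (r / 2) ^ 4 * (5 / 2 * r) * ‖z - y‖) * M) * (2 * r) ^ 3 :=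
    le_trans (by gcongr) hle
  have hr9 : 0 < (r / 2) ^ 9 / 64 := by positivity
  refine le_of_mul_le_mul_left (h5.trans ?_) hr9
  have h6 : (r / 2) ^ 9 / 64 * (400000 / r * M * ‖z - y‖) =
      (400000 / 2 ^ 15) * (r ^ 8 * M * ‖z - y‖) := by
    field_simp
    norm_num
  have h7 : ((9 * (r / 2) ^ 4 * (5 / 2 * r) * ‖z - y‖) * M) * (2 * r) ^ 3 =
      (45 / 4) * (r ^ 8 * M * ‖z - y‖) := by
    ring
  rw [h6, h7]
  exact mul_le_mul_of_nonneg_right (by norm_num) (by positivity)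

lemma MonogenicOn.contDiffAt (he : IsCliffordTriple e) (hV : IsOpen V) (hg : MonogenicOn e g V)
    (hy : y ∈ V) : ContDiffAt ℝ 2 g y := by
  obtain ⟨r, hr, hrV⟩ := nhds_basis_closedBall.mem_iff.1 (hV.mem_nhds hy)
  have hgr := hg.mono hrV
  have hlow := bumpMass_lower_bound (show 0 < r / 4 by positivity)
  have hpos : 0 < bumpMass (r / 4) := lt_of_lt_of_le (by positivity) hlow
  let G := (closedBall y r).indicator g
  have hG : Integrable G := (integrable_indicator_iff measurableSet_closedBall).2
    (hgr.continuousOn.integrableOn_compact (isCompact_closedBall y r))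
  have hsupp : HasCompactSupport (bump (r / 4) 3) := by
    refine HasCompactSupport.intro (isCompact_closedBall 0 (r / 4)) fun x hx => ?_
    refine bump_eq_zero (by positivity) three_ne_zero ?_
    simpa using (not_le.1 (mt mem_closedBall_zero_iff.2 hx)).le
  have hconv := hsupp.contDiff_convolution_right (n := 2) (μ := volume)
    (ContinuousLinearMap.lsmul ℝ ℝ (E := H)).flip hG.locallyIntegrable (contDiff_bump (r / 4))
  have heq : g =ᶠ[nhds y] fun z => (bumpMass (r / 4))⁻¹ •
      convolution G (bump (r / 4) 3) (ContinuousLinearMap.lsmul ℝ ℝ (E := H)).flip volume z := by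
    filter_upwards [closedBall_mem_nhds y (show 0 < r / 4 by positivity)] with z hz
    have hzn : ‖z - y‖ ≤ r / 4 := by simpa [dist_eq_norm] using hz
    have hsub : closedBall z (3 / 4 * r) ⊆ closedBall y r :=
      closedBall_subset_closedBall' (by rw [dist_eq_norm]; linarith)
    have hmz := hgr.setIntegral_bump he (s := r / 4) ⟨by positivity, by linarith⟩
      measurableSet_closedBall hsub
    rw [eq_inv_smul_iff₀ hpos.ne', ← hmz, ← integral_indicator measurableSet_closedBall,
      convolution_def]
    congr 1
    funext x
    have hsym : bump (r / 4) 3 (z - x) = bump (r / 4) 3 (x - z) := by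
      unfold bump
      simp only [Pi.sub_apply, sub_sq_comm]
    by_cases hx : x ∈ closedBall y r <;> simp [G, hx, hsym]
  exact ((hconv.const_smul _).contDiffAt).congr_of_eventuallyEq heq

/-- Directional derivatives of monogenic functions are monogenic. -/
lemma MonogenicOn.fderiv_apply (he : IsCliffordTriple e) (hV : IsOpen V) (hg : MonogenicOn e g V)
    (v : Fin 3 → ℝ) : MonogenicOn e (fun x => fderiv ℝ g x v) V := by
  intro u hu
  have hc := hg.contDiffAt he hV hu
  have hsymm : IsSymmSndFDerivAt ℝ g u := hc.isSymmSndFDerivAt (by simp)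
  have hd : DifferentiableAt ℝ (fderiv ℝ g) u :=
    (hc.fderiv_right (m := 1) (by norm_num)).differentiableAt one_ne_zero
  have hap : ∀ w, HasFDerivAt (fun x => fderiv ℝ g x w) ((fderiv ℝ (fderiv ℝ g) u).flip w) u :=
    fun w => by simpa using! hd.hasFDerivAt.clm_apply (hasFDerivAt_const w u)
  refine ⟨(hap v).differentiableAt, ?_⟩
  have h0 : (fun x => ∑ i, e i * fderiv ℝ g x (Pi.single i 1)) =ᶠ[nhds u] fun _ => 0 := by
    filter_upwards [hV.mem_nhds hu] with x hx using (hg x hx).2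
  have h1 := HasFDerivAt.fun_sum (u := Finset.univ)
    fun i _ => (hap (Pi.single i (1 : ℝ))).const_mul (e i)
  have h2 := h1.unique ((hasFDerivAt_const (0 : H) u).congr_of_eventuallyEq h0)
  have h3 := congrArg (fun φ : (Fin 3 → ℝ) →L[ℝ] H => φ v) h2
  simp only [(hap v).fderiv, ContinuousLinearMap.flip_apply]
  simpa [fun w => hsymm.eq v w] using h3

/-- The derivative of `g` in the direction `v`. -/
def dirDeriv (v : Fin 3 → ℝ) (g : (Fin 3 → ℝ) → H) (x : Fin 3 → ℝ) : H := fderiv ℝ g x v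

lemma MonogenicOn.iterate_dirDeriv (he : IsCliffordTriple e) (hV : IsOpen V)
    (hg : MonogenicOn e g V) (v : Fin 3 → ℝ) (k : ℕ) : MonogenicOn e ((dirDeriv v)^[k] g) V := by
  induction k generalizing g with
  | zero => exact hg
  | succ k ih => exact ih (hg.fderiv_apply he hV v)

/-- Cauchy estimates for iterated directional derivatives. -/
lemma MonogenicOn.norm_iterate_dirDeriv_le (he : IsCliffordTriple e) (hV : IsOpen V)
    (hg : MonogenicOn e g V) {v : Fin 3 → ℝ} (hv : ‖v‖ ≤ 1) {r M : ℝ} (hr : 0 < r) (k : ℕ)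
    (hk : closedBall y (k * r) ⊆ V) (hM : ∀ x ∈ closedBall y (k * r), ‖g x‖ ≤ M) :
    ‖(dirDeriv v)^[k] g y‖ ≤ (400000 / r) ^ k * M := by
  induction k generalizing g y M with
  | zero => simpa using hM y (by simp)
  | succ k ih =>
    have hsub : ∀ z ∈ closedBall y (k * r), closedBall z r ⊆ closedBall y ((k + 1 : ℕ) * r) :=
      fun z hz => closedBall_subset_closedBall' (by
        have := mem_closedBall.1 hz
        push_cast
        linarith)
    have hkk : closedBall y (k * r) ⊆ closedBall y ((k + 1 : ℕ) * r) :=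
      closedBall_subset_closedBall (by push_cast; linarith)
    rw [Function.iterate_succ_apply, pow_succ, mul_assoc]
    refine ih (hg.fderiv_apply he hV v) (hkk.trans hk) fun z hz => ?_
    have h1 := (hg.mono ((hsub z hz).trans hk)).norm_fderiv_le he hr
      fun x hx => hM x (hsub z hz hx)
    exact ((fderiv ℝ g z).le_of_opNorm_le h1 v).trans
      (mul_le_of_le_one_right ((fderiv ℝ g z).opNorm_nonneg.trans h1) hv)

lemma norm_le_of_iterated_deriv_zero {G : ℕ → ℝ → H} {T B : ℝ}
    (hG : ∀ k, ∀ t ∈ Set.Icc 0 T, HasDerivAt (G k) (G (k + 1) t) t) (h0 : ∀ k, G k 0 = 0) (n : ℕ)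
    (hB : ∀ t ∈ Set.Icc 0 T, ‖G n t‖ ≤ B) :
    ∀ t ∈ Set.Icc 0 T, ‖G 0 t‖ ≤ B * (t ^ n / n.factorial) := by
  induction n generalizing G with
  | zero => simpa using hB
  | succ n ih =>
    have h1 := ih (G := fun k => G (k + 1)) (fun k => hG (k + 1)) (fun k => h0 (k + 1)) hB
    have hder : ∀ x : ℝ, HasDerivAt (fun t : ℝ => B * (t ^ (n + 1) / (n + 1).factorial))
        (B * (x ^ n / n.factorial)) x := fun x => by
      refine (((hasDerivAt_pow (n + 1) x).div_const _).const_mul B).congr_deriv ?_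
      rw [Nat.factorial_succ]
      push_cast
      field_simp
    intro t ht
    exact image_norm_le_of_norm_deriv_right_le_deriv_boundary
      (fun x hx => (hG 0 x hx).continuousAt.continuousWithinAt)
      (fun x hx => (hG 0 x (Set.Ico_subset_Icc_self hx)).hasDerivWithinAt)
      (by simp [h0]) hder (fun x hx => h1 x (Set.Ico_subset_Icc_self hx)) ht

/-- A monogenic function with vanishing jet in direction `v` vanishes along a segment whose length
is a fixed fraction of the distance to the boundary. -/
lemma MonogenicOn.eq_zero_of_iterate_dirDeriv (he : IsCliffordTriple e) (hV : IsOpen V)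
    (hg : MonogenicOn e g V) {v : Fin 3 → ℝ} (hv : ‖v‖ ≤ 1) {r : ℝ} (hr : 0 < r)
    (hy : closedBall y (2 * r) ⊆ V) (h0 : ∀ k, (dirDeriv v)^[k] g y = 0) {t : ℝ} (ht : 0 ≤ t)
    (htr : t ≤ r / 2400000) : g (y + t • v) = 0 := by
  obtain ⟨M, hM⟩ := (isCompact_closedBall y (2 * r)).exists_bound_of_continuousOn
    (hg.mono hy).continuousOn
  have hM0 : 0 ≤ M := (norm_nonneg _).trans (hM y (mem_closedBall_self (by positivity)))
  have hmem : ∀ u ∈ Set.Icc 0 t, closedBall (y + u • v) r ⊆ closedBall y (2 * r) := fun u hu => by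
    refine closedBall_subset_closedBall' ?_
    have h1 : ‖u • v‖ ≤ u * 1 := by
      rw [norm_smul, Real.norm_of_nonneg hu.1]
      exact mul_le_mul_of_nonneg_left hv hu.1
    have h2 := hu.2
    simp only [dist_eq_norm, add_sub_cancel_left]
    linarith
  have hder : ∀ k, ∀ u ∈ Set.Icc 0 t, HasDerivAt (fun u : ℝ => (dirDeriv v)^[k] g (y + u • v))
      ((dirDeriv v)^[k + 1] g (y + u • v)) u := fun k u hu => by
    have hd := (hg.iterate_dirDeriv he hV v k _
      (hy (hmem u hu (mem_closedBall_self hr.le)))).1.hasFDerivAt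
    have hl : HasDerivAt (fun u : ℝ => y + u • v) v u := by
      simpa using ((hasDerivAt_id u).smul_const v).const_add y
    rw [Function.iterate_succ_apply']
    exact hd.comp_hasDerivAt u hl
  have hbound : ∀ n : ℕ, ‖g (y + t • v)‖ ≤ M * (1 / 2) ^ (n + 1) := fun n => by
    set N : ℝ := ((n + 1 : ℕ) : ℝ) with hN
    have hNpos : 0 < N := by positivity
    have h1 := norm_le_of_iterated_deriv_zero hder (fun k => by simpa using h0 k) (n + 1)
      (B := (400000 / (r / N)) ^ (n + 1) * M) (fun u hu => by
        have hk : N * (r / N) = r := by field_simp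
        refine hg.norm_iterate_dirDeriv_le he hV hv (by positivity) (n + 1) ?_ ?_ <;>
          rw [← hN, hk]
        · exact (hmem u hu).trans hy
        · exact fun x hx => hM x (hmem u hu hx)) t ⟨ht, le_rfl⟩
    have h2 : N ^ (n + 1) / (n + 1).factorial ≤ 3 ^ (n + 1) := by
      refine (Real.pow_div_factorial_le_exp N hNpos.le (n + 1)).trans ?_
      rw [hN, ← mul_one ((n + 1 : ℕ) : ℝ), Real.exp_nat_mul]
      gcongr
      exact Real.exp_one_lt_three.le
    calc ‖g (y + t • v)‖ ≤ _ := h1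
      _ = M * (400000 / r * t) ^ (n + 1) * (N ^ (n + 1) / (n + 1).factorial) := by
        simp only [div_pow, mul_pow]
        field_simp
      _ ≤ M * (1 / 6) ^ (n + 1) * 3 ^ (n + 1) := by
        gcongr
        rw [div_mul_eq_mul_div, div_le_iff₀ hr]
        linarith
      _ = M * (1 / 2) ^ (n + 1) := by
        rw [mul_assoc, ← mul_pow]
        norm_num
  have hlim : Filter.Tendsto (fun n : ℕ => M * (1 / 2 : ℝ) ^ (n + 1)) Filter.atTop (nhds 0) := by
    simpa using ((Filter.tendsto_add_atTop_iff_nat 1).2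
      (tendsto_pow_atTop_nhds_zero_of_lt_one (r := (1 / 2 : ℝ)) (by norm_num)
        (by norm_num))).const_mul M
  exact norm_le_zero_iff.1 (ge_of_tendsto' hlim hbound)

lemma iterate_dirDeriv_eq_zero_of_eventually (v : Fin 3 → ℝ) (h : ∀ᶠ x in nhds y, g x = 0)
    (k : ℕ) : (dirDeriv v)^[k] g y = 0 := by
  induction k generalizing g with
  | zero => exact h.self_of_nhds
  | succ k ih =>
    refine ih ?_
    filter_upwards [h.eventually_nhds] with x hx
    have : g =ᶠ[nhds x] fun _ => 0 := hx
    simp [dirDeriv, this.fderiv_eq]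

/-- Vanishing on the plane `x₂ = 0` is inherited by the normal derivative. -/
lemma MonogenicOn.dirDeriv_eq_zero_of_plane (he : IsCliffordTriple e) (hV : IsOpen V)
    (hg : MonogenicOn e g V) (h : ∀ x ∈ V, x 2 = 0 → g x = 0) (c : ℝ) :
    ∀ x ∈ V, x 2 = 0 → dirDeriv (Pi.single 2 c) g x = 0 := by
  intro x hx hx2
  have htan : ∀ i : Fin 3, i ≠ 2 → fderiv ℝ g x (Pi.single i 1) = 0 := fun i hi => by
    have hl : HasDerivAt (fun t : ℝ => x + t • Pi.single i (1 : ℝ)) (Pi.single i 1) 0 := by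
      simpa using ((hasDerivAt_id (0 : ℝ)).smul_const (Pi.single i (1 : ℝ))).const_add x
    have hx0 : x + (0 : ℝ) • Pi.single i (1 : ℝ) = x := by simp
    have hd := (hg x hx).1.hasFDerivAt
    rw [← hx0] at hd
    have hz : (fun t : ℝ => g (x + t • Pi.single i (1 : ℝ))) =ᶠ[nhds 0] fun _ => 0 := by
      have hmem : ∀ᶠ t : ℝ in nhds 0, x + t • Pi.single i (1 : ℝ) ∈ V :=
        hl.continuousAt.eventually_mem (by rw [hx0]; exact hV.mem_nhds hx)
      filter_upwards [hmem] with t ht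
      exact h _ ht (by simp [hx2, hi.symm])
    have := (hd.comp_hasDerivAt 0 hl).unique ((hasDerivAt_const _ (0 : H)).congr_of_eventuallyEq hz)
    rwa [hx0] at this
  have hone : star (e 2) * e 2 = 1 := by
    simpa [Fin.sum_univ_three] using he (Pi.single 2 1)
  have h1 := (hg x hx).2
  rw [Fin.sum_univ_three, htan 0 (by decide), htan 1 (by decide)] at h1
  simp only [mul_zero, zero_add] at h1
  have h2 : fderiv ℝ g x (Pi.single 2 1) = 0 := by
    rw [← one_mul (fderiv ℝ g x (Pi.single 2 1)), ← hone, mul_assoc, h1, mul_zero]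
  have h3 : (Pi.single 2 c : Fin 3 → ℝ) = c • Pi.single 2 1 := by
    rw [← Pi.single_smul]; simp
  rw [dirDeriv, h3, map_smul, h2, smul_zero]

lemma MonogenicOn.iterate_dirDeriv_eq_zero_of_plane (he : IsCliffordTriple e) (hV : IsOpen V)
    (hg : MonogenicOn e g V) (h : ∀ x ∈ V, x 2 = 0 → g x = 0) (c : ℝ) (k : ℕ) :
    ∀ x ∈ V, x 2 = 0 → (dirDeriv (Pi.single 2 c))^[k] g x = 0 := by
  induction k generalizing g with
  | zero => exact h
  | succ k ih => exact ih (hg.fderiv_apply he hV _) (hg.dirDeriv_eq_zero_of_plane he hV h c)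

lemma MonogenicOn.eventually_eq_zero_of_plane (he : IsCliffordTriple e) (hV : IsOpen V)
    (hg : MonogenicOn e g V) (h : ∀ x ∈ V, x 2 = 0 → g x = 0) (hy : y ∈ V) (hy2 : y 2 = 0) :
    ∀ᶠ x in nhds y, g x = 0 := by
  obtain ⟨ρ, hρ, hρV⟩ := nhds_basis_closedBall.mem_iff.1 (hV.mem_nhds hy)
  filter_upwards [closedBall_mem_nhds y (show 0 < ρ / 3 / 2400000 by positivity)] with z hz
  have hzn : ‖z - y‖ ≤ ρ / 3 / 2400000 := by simpa [dist_eq_norm] using hz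
  have hz2 : |z 2| ≤ ρ / 3 / 2400000 := by
    simpa [hy2] using (norm_le_pi_norm (z - y) 2).trans hzn
  set w := Function.update z 2 0 with hw
  have hwy : ‖w - y‖ ≤ ρ / 3 / 2400000 := by
    refine (pi_norm_le_iff_of_nonneg (by positivity)).2 fun i => ?_
    by_cases hi : i = 2
    · subst hi
      simp only [hw, Pi.sub_apply, Function.update_self, hy2, sub_zero, norm_zero]
      positivity
    · simpa [hw, hi] using (norm_le_pi_norm (z - y) i).trans hzn
  have hwV : closedBall w (2 * (ρ / 3)) ⊆ V :=
    (closedBall_subset_closedBall' (by rw [dist_eq_norm]; linarith)).trans hρV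
  obtain ⟨c, hc, hcz⟩ : ∃ c : ℝ, |c| ≤ 1 ∧ |z 2| * c = z 2 := by
    rcases le_total 0 (z 2) with h | h
    · exact ⟨1, by simp, by simp [abs_of_nonneg h]⟩
    · exact ⟨-1, by simp, by simp [abs_of_nonpos h]⟩
  have hzw : z = w + |z 2| • Pi.single 2 c := by
    funext i
    by_cases hi : i = 2
    · subst hi; simp [hw, hcz]
    · simp [hw, hi]
  rw [hzw]
  exact hg.eq_zero_of_iterate_dirDeriv he hV (by simpa [Pi.norm_single] using hc)
    (by positivity) hwV
    (fun k => hg.iterate_dirDeriv_eq_zero_of_plane he hV h c k w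
      (hwV (mem_closedBall_self (by positivity))) (by simp [hw]))
    (abs_nonneg _) hz2

/-- Identity principle: a monogenic function on a connected open set that vanishes on the plane
`x₂ = 0` vanishes identically, as soon as the plane meets the set. -/
theorem MonogenicOn.eq_zero_of_plane (he : IsCliffordTriple e) (hV : IsOpen V)
    (hVc : IsPreconnected V) (hg : MonogenicOn e g V) (h : ∀ x ∈ V, x 2 = 0 → g x = 0)
    (hy : y ∈ V) (hy2 : y 2 = 0) : ∀ x ∈ V, g x = 0 := by
  suffices hsub : V ⊆ {z | ∀ᶠ x in nhds z, g x = 0} from fun x hx => (hsub hx).self_of_nhds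
  refine hVc.subset_of_closure_inter_subset isOpen_setOfPred_eventually_nhds
    ⟨y, hy, hg.eventually_eq_zero_of_plane he hV h hy hy2⟩ ?_
  rintro z ⟨hzc, hzV⟩
  obtain ⟨ρ, hρ, hρV⟩ := nhds_basis_closedBall.mem_iff.1 (hV.mem_nhds hzV)
  obtain ⟨w, hw, hwz⟩ := Metric.mem_closure_iff.1 hzc (ρ / 3 / 2400000 / 2) (by positivity)
  rw [dist_comm, dist_eq_norm] at hwz
  have hwV : closedBall w (2 * (ρ / 3)) ⊆ V :=
    (closedBall_subset_closedBall' (by rw [dist_eq_norm]; linarith)).trans hρV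
  filter_upwards [closedBall_mem_nhds z (show 0 < ρ / 3 / 2400000 / 2 by positivity)] with x hx
  have hxz : ‖x - z‖ ≤ ρ / 3 / 2400000 / 2 := by simpa [dist_eq_norm] using hx
  have hxw : ‖x - w‖ ≤ ρ / 3 / 2400000 := by
    have h1 := norm_sub_le (x - z) (w - z)
    rw [sub_sub_sub_cancel_right] at h1
    linarith
  have hxe : x = w + ‖x - w‖ • (‖x - w‖⁻¹ • (x - w)) := by
    rcases eq_or_ne (x - w) 0 with h0 | h0
    · simp [sub_eq_zero.1 h0]
    · rw [smul_inv_smul₀ (norm_ne_zero_iff.2 h0)]; abel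
  rw [hxe]
  refine hg.eq_zero_of_iterate_dirDeriv he hV ?_ (by positivity) hwV
    (iterate_dirDeriv_eq_zero_of_eventually _ hw) (norm_nonneg _) hxw
  rw [norm_smul, norm_inv, norm_norm]
  exact inv_mul_le_one

lemma MonogenicOn.sub {h : (Fin 3 → ℝ) → H} (hg : MonogenicOn e g V) (hh : MonogenicOn e h V) :
    MonogenicOn e (fun x => g x - h x) V := fun u hu =>
  ⟨(hg u hu).1.sub (hh u hu).1, by
    rw [fderiv_fun_sub (hg u hu).1 (hh u hu).1]
    simp only [sub_apply, mul_sub, Finset.sum_sub_distrib, (hg u hu).2, (hh u hu).2, sub_zero]⟩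

lemma MonogenicOn.const_mul {e' : Fin 3 → H} (hg : MonogenicOn e' g V) {a : H}
    (ha : ∀ i, e i * a = a * e' i) : MonogenicOn e (fun x => a * g x) V := fun u hu =>
  ⟨(hg u hu).1.const_mul a, by
    have h := ((hg u hu).1.hasFDerivAt.const_mul a).fderiv
    simp only [h, smul_apply, smul_eq_mul, ← mul_assoc, ha]
    simp only [mul_assoc, ← Finset.mul_sum, (hg u hu).2, mul_zero]⟩

/-- The coordinates `psi J` of `ℝ³_J`, on `Fin 3 → ℝ`. -/
def hplaneCoord (J : H) (x : Fin 3 → ℝ) : H := psi J (x 0, x 1, x 2)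

lemma continuous_hplaneCoord (J : H) : Continuous (hplaneCoord J) := by
  unfold hplaneCoord psi
  have := Quaternion.continuous_coe
  fun_prop

lemma JMonogenicOn.monogenicOn {J : H} {f : H → H} {Ω : Set H} (hf : JMonogenicOn J f Ω) :
    MonogenicOn ![1, qi, J] (fun x => f (hplaneCoord J x)) (hplaneCoord J ⁻¹' Ω) := by
  intro u hu
  obtain ⟨hd, h0⟩ := hf _ hu
  let P : (Fin 3 → ℝ) →L[ℝ] ℝ × ℝ × ℝ := (ContinuousLinearMap.proj 0).prod
    ((ContinuousLinearMap.proj 1).prod (ContinuousLinearMap.proj 2))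
  have h := hd.hasFDerivAt.comp (f := P) u P.hasFDerivAt
  have h' : HasFDerivAt (fun x => f (hplaneCoord J x)) _ u := h
  refine ⟨h'.differentiableAt, ?_⟩
  rw [h'.fderiv, Fin.sum_univ_three]
  simpa [P] using h0

@[simp] lemma qi_re : qi.re = 0 := rfl

@[simp] lemma qi_imI : qi.imI = 1 := rfl

@[simp] lemma qi_imJ : qi.imJ = 0 := rfl

@[simp] lemma qi_imK : qi.imK = 0 := rfl

lemma isCliffordTriple_of_mem_S1 {J : H} (hJ : J ∈ S1) : IsCliffordTriple ![1, qi, J] := by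
  obtain ⟨h0, h1, h2⟩ := hJ
  intro x
  rw [Quaternion.star_mul_self]
  congr 1
  simp [Quaternion.normSq_def', Fin.sum_univ_three, h0, h1]
  linear_combination x 2 ^ 2 * h2

lemma mul_self_of_mem_S1 {J : H} (hJ : J ∈ S1) : J * J = -1 := by
  obtain ⟨h0, h1, h2⟩ := hJ
  ext <;> simp [h0, h1]
  · linarith
  · ring

lemma qi_mul_of_mem_S1 {J : H} (hJ : J ∈ S1) : qi * J = -(J * qi) := by
  obtain ⟨h0, h1, h2⟩ := hJ
  ext <;> simp [h0, h1]

lemma mul_inv_of_anticomm {a d : H} (h : a * d = -(d * a)) : a * d⁻¹ = -(d⁻¹ * a) := by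
  rcases eq_or_ne d 0 with rfl | hd
  · simp
  · have : d * (a * d⁻¹) = d * (-(d⁻¹ * a)) := by
      rw [mul_neg, mul_inv_cancel_left₀ hd, ← mul_assoc, ← neg_eq_iff_eq_neg.2 h, neg_mul,
        mul_assoc, mul_inv_cancel₀ hd, mul_one]
    exact mul_left_cancel₀ hd this

lemma intertwine {I J D : H} (hI : I ∈ S1) (hJ : J ∈ S1) (hD : qi * D = -(D * qi)) (i : Fin 3) :
    ![1, qi, I] i * (D⁻¹ * J + I * D⁻¹) = (D⁻¹ * J + I * D⁻¹) * ![1, qi, J] i := by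
  have hI2 := mul_self_of_mem_S1 hI
  have hJ2 := mul_self_of_mem_S1 hJ
  fin_cases i
  · simp
  · have h1 := mul_inv_of_anticomm hD
    have h2 := qi_mul_of_mem_S1 hI
    have h3 := qi_mul_of_mem_S1 hJ
    simp only [Fin.mk_one, Matrix.cons_val_one, Matrix.cons_val_zero, mul_add, add_mul]
    rw [← mul_assoc qi, h1, ← mul_assoc qi, h2, neg_mul, neg_mul, mul_assoc, h3, mul_assoc I, h1]
    simp only [mul_neg, neg_neg, mul_assoc]
  · simp only [Fin.reduceFinMk, Matrix.cons_val, mul_add, add_mul]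
    rw [← mul_assoc I I, hI2, mul_assoc _ J J, hJ2, add_comm]
    simp [mul_assoc]

lemma hplaneCoord_eq (J : H) (x : Fin 3 → ℝ) :
    hplaneCoord J x = ((x 0 : H) + x 1 • qi) + x 2 • J := rfl

lemma coe_add_smul_qi_mem (a b : ℝ) : (a : H) + b • qi ∈ Cset := by
  constructor <;> simp

lemma eq_of_mem_Cset {z : H} (hz : z ∈ Cset) : z = (z.re : H) + z.imI • qi := by
  obtain ⟨h1, h2⟩ := hz
  ext <;> simp [h1, h2]

lemma preimage_hplaneCoord_subset {Ω : Set H} (hsym : IsSymmetric13 Ω) {I J : H} (hI : I ∈ S1)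
    (hJ : J ∈ S1) : hplaneCoord I ⁻¹' Ω ⊆ hplaneCoord J ⁻¹' Ω := fun x hx =>
  hsym _ (coe_add_smul_qi_mem (x 0) (x 1)) (x 2) I hI hx J hJ

lemma isPreconnected_preimage_hplaneCoord {Ω : Set H} {J : H} (hJ : J ∈ S1)
    (h : IsPreconnected (Ω ∩ hplane J)) : IsPreconnected (hplaneCoord J ⁻¹' Ω) := by
  let L : H → Fin 3 → ℝ := fun q => ![q.re, q.imI, q.imJ * J.imJ + q.imK * J.imK]
  have hL : Continuous L := by
    have := Quaternion.continuous_re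
    have := Quaternion.continuous_imI
    have := Quaternion.continuous_imJ
    have := Quaternion.continuous_imK
    refine continuous_pi fun i => ?_
    fin_cases i <;> simp only [L] <;> dsimp <;> fun_prop
  obtain ⟨h0, h1, h2⟩ := hJ
  have hLx : ∀ x, L (hplaneCoord J x) = x := fun x => by
    funext i
    fin_cases i <;> simp [L, hplaneCoord_eq, h0, h1]
    linear_combination x 2 * h2
  have himg : hplaneCoord J ⁻¹' Ω = L '' (Ω ∩ hplane J) := by
    ext x
    constructor
    · exact fun hx => ⟨hplaneCoord J x, ⟨hx, _, rfl⟩, hLx x⟩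
    · rintro ⟨_, ⟨hq, ⟨a, b, c⟩, rfl⟩, rfl⟩
      have : psi J (a, b, c) = hplaneCoord J ![a, b, c] := rfl
      rw [this] at hq ⊢
      rw [hLx]
      exact hq
  rw [himg]
  exact h.image L hL.continuousOn

theorem representation_formula {Ω : Set H} (hΩ : IsSliceDomain13 Ω) (hsym : IsSymmetric13 Ω)
    {f : H → H} (hf : Regular13 f Ω) {z : H} (hz : z ∈ Cset) (β : ℝ) {I J K : H} (hI : I ∈ S1)
    (hJ : J ∈ S1) (hK : K ∈ S1) (hJK : J ≠ K) (hzI : z + β • I ∈ Ω) :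
    f (z + β • I) =
      ((J - K)⁻¹ * J + I * (J - K)⁻¹) * f (z + β • J)
        - ((J - K)⁻¹ * K + I * (J - K)⁻¹) * f (z + β • K) := by
  obtain ⟨hopen, -, ⟨w, hwΩ, hwC⟩, hslice⟩ := hΩ
  set V := hplaneCoord I ⁻¹' Ω with hV
  have hVo : IsOpen V := hopen.preimage (continuous_hplaneCoord I)
  have hVc : IsPreconnected V :=
    isPreconnected_preimage_hplaneCoord hI (hslice I hI).isPreconnected
  have hmI := (hf I hI).monogenicOn
  have hmJ := (hf J hJ).monogenicOn.mono (preimage_hplaneCoord_subset hsym hI hJ)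
  have hmK := (hf K hK).monogenicOn.mono (preimage_hplaneCoord_subset hsym hI hK)
  have hD : qi * (J - K) = -((J - K) * qi) := by
    rw [mul_sub, qi_mul_of_mem_S1 hJ, qi_mul_of_mem_S1 hK, sub_mul]
    abel
  have hm := hmI.sub ((hmJ.const_mul (intertwine hI hJ hD)).sub
    (hmK.const_mul (intertwine hI hK hD)))
  have hw : hplaneCoord I ![w.re, w.imI, 0] = w := by
    rw [hplaneCoord_eq]
    simpa using (eq_of_mem_Cset hwC).symm
  have hzero := hm.eq_zero_of_plane (isCliffordTriple_of_mem_S1 hI) hVo hVc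
    (y := ![w.re, w.imI, 0]) (fun x _ hx2 => by
      have h1 : (J - K)⁻¹ * J - (J - K)⁻¹ * K = 1 := by
        rw [← mul_sub, inv_mul_cancel₀ (sub_ne_zero.2 hJK)]
      simp only [hplaneCoord_eq, hx2, zero_smul, add_zero]
      rw [← sub_mul, add_sub_add_right_eq_sub, h1, one_mul, sub_self])
    (by rw [hV, Set.mem_preimage, hw]; exact hwΩ) (by simp)
  have hcoord : ∀ L : H, hplaneCoord L ![z.re, z.imI, β] = z + β • L := fun L => by
    rw [hplaneCoord_eq]
    simpa using (eq_of_mem_Cset hz).symm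
  have := hzero ![z.re, z.imI, β] (by rw [hV, Set.mem_preimage, hcoord]; exact hzI)
  simp only [hcoord] at this
  exact sub_eq_zero.1 this

end MonogenicFunctions

/-- Representation Formula: for a `(1,3)`-regular function `f` on a
`(1,3)`-symmetric `(1,3)`-slice domain `Ω`, for all `z ∈ ℂ`, `β ∈ ℝ` and
`I, J, K ∈ S¹` with `J ≠ K` such that `z + βI ∈ Ω`:
`f(z+βI) = ((J−K)⁻¹J + I(J−K)⁻¹)·f(z+βJ) − ((J−K)⁻¹K + I(J−K)⁻¹)·f(z+βK)`;
in particular `f(z+βI) = ((1−IJ)/2)·f(z+βJ) + ((1+IJ)/2)·f(z−βJ)`. -/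
theorem stmt18 (Ω : Set H) (hΩ : IsSliceDomain13 Ω) (hsym : IsSymmetric13 Ω)
    (f : H → H) (hf : Regular13 f Ω) :
    (∀ z ∈ Cset, ∀ β : ℝ, ∀ I ∈ S1, ∀ J ∈ S1, ∀ K ∈ S1, J ≠ K →
      z + β • I ∈ Ω →
      f (z + β • I) =
        ((J - K)⁻¹ * J + I * (J - K)⁻¹) * f (z + β • J)
          - ((J - K)⁻¹ * K + I * (J - K)⁻¹) * f (z + β • K)) ∧
    (∀ z ∈ Cset, ∀ β : ℝ, ∀ I ∈ S1, ∀ J ∈ S1,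
      z + β • I ∈ Ω →
      f (z + β • I) =
        ((1 - I * J) / 2) * f (z + β • J) + ((1 + I * J) / 2) * f (z - β • J)) := by
  refine ⟨fun z hz β I hI J hJ K hK hJK hzI =>
    representation_formula hΩ hsym hf hz β hI hJ hK hJK hzI, fun z hz β I hI J hJ hzI => ?_⟩
  have hK : -J ∈ S1 := by
    obtain ⟨h0, h1, h2⟩ := hJ
    exact ⟨by simp [h0], by simp [h1], by simpa using h2⟩
  have hJ2 := mul_self_of_mem_S1 hJ
  have hne : J ≠ -J := fun h => by
    have h1 : (2 : ℝ) • J = 0 := by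
      rw [two_smul]
      exact eq_neg_iff_add_eq_zero.1 h
    have h2 : J = 0 := (smul_eq_zero_iff_right two_ne_zero).1 h1
    simp [h2] at hJ2
  have hinv : (J - -J)⁻¹ = -((1 / 2 : ℝ) • J) := by
    refine (eq_inv_of_mul_eq_one_left ?_).symm
    rw [sub_neg_eq_add, ← two_smul ℝ J, neg_mul, smul_mul_smul_comm, hJ2]
    norm_num
  have hdiv : ∀ q : H, q / 2 = (1 / 2 : ℝ) • q := fun q => by
    have h2 : (2 : H) = ((2 : ℝ) : H) := by norm_cast
    rw [h2, div_eq_mul_inv, ← Quaternion.coe_inv, Quaternion.mul_coe_eq_smul, one_div]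
  have hA : (J - -J)⁻¹ * J + I * (J - -J)⁻¹ = (1 - I * J) / 2 := by
    rw [hinv, hdiv]
    simp only [neg_mul, mul_neg, smul_mul_assoc, mul_smul_comm, hJ2]
    module
  have hB : (J - -J)⁻¹ * -J + I * (J - -J)⁻¹ = -((1 + I * J) / 2) := by
    rw [hinv, hdiv]
    simp only [neg_mul, mul_neg, smul_mul_assoc, mul_smul_comm, hJ2]
    module
  rw [representation_formula hΩ hsym hf hz β hI hJ hK hne hzI, hA, hB, smul_neg,
    ← sub_eq_add_neg, neg_mul, sub_neg_eq_add]
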